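/- If a finite simple graph G satisfies that for every nonempty subset V' of its vertices, the induced subgraph G[V'] has at most 2|V'| - 2 edges, then the edge set of G can be partitioned into two forests. -/

import Mathlib

open SimpleGraph

/-- The subgraph of `G` consisting of the edges of `G` receiving color `i` under `f`. -/
def colorClass {V : Type*} {β : Type*} (G : SimpleGraph V) (f : Sym2 V → β) (i : β) :
    SimpleGraph V :=
  SimpleGraph.fromEdgeSet {e | e ∈ G.edgeSet ∧ f e = i}

namespace SimpleGraph

variable {V β : Type*} {G H : SimpleGraph V} {f : Sym2 V → β} {i : β} {e : Sym2 V} {x y : V}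

lemma colorClass_adj : (colorClass G f i).Adj x y ↔ G.Adj x y ∧ f s(x, y) = i := by
  rw [colorClass, fromEdgeSet_adj]
  exact ⟨fun h ↦ h.1, fun h ↦ ⟨h, h.1.ne⟩⟩

lemma colorClass_mono (h : G ≤ H) : colorClass G f i ≤ colorClass H f i := fun _ _ hxy ↦
  colorClass_adj.2 ⟨h (colorClass_adj.1 hxy).1, (colorClass_adj.1 hxy).2⟩

lemma colorClass_le : colorClass G f i ≤ G := fun _ _ hxy ↦ (colorClass_adj.1 hxy).1

lemma deleteEdges_comm (s t : Set (Sym2 V)) :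
    (G.deleteEdges s).deleteEdges t = (G.deleteEdges t).deleteEdges s := by
  simp [deleteEdges_deleteEdges, Set.union_comm]

lemma colorClass_deleteEdges (s : Set (Sym2 V)) :
    colorClass (G.deleteEdges s) f i = (colorClass G f i).deleteEdges s := by
  ext x y
  simp only [colorClass_adj, deleteEdges_adj]
  tauto

lemma IsAcyclic.not_reachable_deleteEdges (hG : G.IsAcyclic) (p : G.Path x y)
    (he : e ∈ (p : G.Walk x y).edges) : ¬ (G.deleteEdges {e}).Reachable x y := by
  classical
  rintro ⟨q⟩
  have hle := G.deleteEdges_le {e}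
  have h := (hG.subsingleton_path x y).elim p ⟨q.toPath.1.mapLe hle, q.toPath.2.mapLe hle⟩
  rw [h] at he
  simp only [Walk.edges_mapLe_eq_edges] at he
  simpa using Walk.edges_subset_edgeSet _ he

/-- Recoloring an edge with a color whose class does not connect its ends creates no cycle. -/
lemma isAcyclic_colorClass_update [DecidableEq (Sym2 V)]
    (hf : ∀ j, (colorClass (G.deleteEdges {s(x, y)}) f j).IsAcyclic)
    (hxy : ¬ (colorClass (G.deleteEdges {s(x, y)}) f i).Reachable x y) (j : β) :
    (colorClass G (Function.update f s(x, y) i) j).IsAcyclic := by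
  by_cases hj : j = i
  · subst hj
    refine ((hf j).sup_edge_of_not_reachable hxy).anti fun a b hab ↦ ?_
    obtain ⟨h1, h2⟩ := colorClass_adj.1 hab
    by_cases h : s(a, b) = s(x, y)
    · right
      rw [edge_adj]
      exact ⟨by simpa using h, h1.ne⟩
    · left
      rw [Function.update_of_ne h] at h2
      exact colorClass_adj.2 ⟨by simpa [deleteEdges_adj, h1] using h, h2⟩
  · refine (hf j).anti fun a b hab ↦ ?_
    obtain ⟨h1, h2⟩ := colorClass_adj.1 hab
    by_cases h : s(a, b) = s(x, y)
    · rw [h, Function.update_self] at h2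
      exact absurd h2.symm hj
    · rw [Function.update_of_ne h] at h2
      exact colorClass_adj.2 ⟨by simpa [deleteEdges_adj, h1] using h, h2⟩

/-- `IsForestColoringOff G p` says that `p.1` colors the edges of `G` other than the edge `p.2`
in such a way that every color class is a forest. -/
def IsForestColoringOff (G : SimpleGraph V) (p : (Sym2 V → β) × Sym2 V) : Prop :=
  p.2 ∈ G.edgeSet ∧ ∀ j, (colorClass (G.deleteEdges {p.2}) p.1 j).IsAcyclic

open Classical in
/-- One forest coloring off an edge arises from another by an exchange if the omitted edge
receives the color of the newly omitted one. -/
def IsExchange (G : SimpleGraph V) (p q : (Sym2 V → β) × Sym2 V) : Prop :=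
  IsForestColoringOff G q ∧ ∃ i, q.1 = Function.update p.1 p.2 i

/-- The graph of all edges that can be made the omitted one by a sequence of exchanges. -/
def exchangeGraph (G : SimpleGraph V) (p : (Sym2 V → β) × Sym2 V) : SimpleGraph V :=
  fromEdgeSet {e | ∃ f, Relation.ReflTransGen (IsExchange G) p (f, e)}

variable {p q : (Sym2 V → β) × Sym2 V}

lemma IsForestColoringOff.of_reflTransGen (hp : IsForestColoringOff G p)
    (hpq : Relation.ReflTransGen (IsExchange G) p q) : IsForestColoringOff G q := by
  cases hpq with
  | refl => exact hp
  | tail _ h => exact h.1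

lemma IsForestColoringOff.reachable (hG : ¬ ∃ f : Sym2 V → β, ∀ i, (colorClass G f i).IsAcyclic)
    (hf : IsForestColoringOff G (f, s(x, y))) (i : β) :
    (colorClass (G.deleteEdges {s(x, y)}) f i).Reachable x y := by
  classical
  by_contra h
  exact hG ⟨_, isAcyclic_colorClass_update hf.2 h⟩

lemma reachable_inf_exchangeGraph_omitted
    (hG : ¬ ∃ f : Sym2 V → β, ∀ i, (colorClass G f i).IsAcyclic)
    (hp : IsForestColoringOff G p) (h : Relation.ReflTransGen (IsExchange G) p (f, s(x, y)))
    (i : β) :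
    (colorClass (G.deleteEdges {s(x, y)}) f i ⊓ exchangeGraph G p).Reachable x y := by
  classical
  have hf := hp.of_reflTransGen h
  obtain ⟨w⟩ := hf.reachable hG i
  refine ⟨w.toPath.1.transfer _ fun e he ↦ ?_⟩
  have hmem := Walk.edges_subset_edgeSet _ he
  have hmem' := edgeSet_mono (colorClass_le.trans (deleteEdges_le _)) hmem
  rw [edgeSet_inf]
  refine ⟨hmem, ?_⟩
  rw [exchangeGraph, edgeSet_fromEdgeSet]
  refine ⟨⟨Function.update f s(x, y) i, h.tail ⟨⟨hmem', ?_⟩, i, rfl⟩⟩,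
    G.not_isDiag_of_mem_edgeSet hmem'⟩
  apply isAcyclic_colorClass_update
  · intro j
    rw [deleteEdges_comm]
    exact (hf.2 j).anti (colorClass_mono (deleteEdges_le _))
  · rw [deleteEdges_comm, colorClass_deleteEdges]
    exact (hf.2 i).not_reachable_deleteEdges w.toPath he

lemma reachable_of_forall_adj (h : ∀ ⦃a b⦄, G.Adj a b → H.Reachable a b)
    (hxy : G.Reachable x y) : H.Reachable x y := by
  obtain ⟨w⟩ := hxy
  induction w with
  | nil => rfl
  | cons hab _ ih => exact (h hab).trans ih

lemma reachable_inf_exchangeGraph_of_isExchange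
    (hG : ¬ ∃ f : Sym2 V → β, ∀ i, (colorClass G f i).IsAcyclic) {r : (Sym2 V → β) × Sym2 V}
    (hp : IsForestColoringOff G p) (hpq : Relation.ReflTransGen (IsExchange G) p q)
    (hqr : IsExchange G q r)
    (h : (colorClass (G.deleteEdges {r.2}) r.1 i ⊓ exchangeGraph G p).Reachable x y) :
    (colorClass (G.deleteEdges {q.2}) q.1 i ⊓ exchangeGraph G p).Reachable x y := by
  classical
  refine reachable_of_forall_adj (fun a b hab ↦ ?_) h
  obtain ⟨f, e⟩ := q
  obtain ⟨h1, h2⟩ := hab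
  obtain ⟨h3, h4⟩ := colorClass_adj.1 h1
  by_cases hne : s(a, b) = e
  · subst hne
    exact reachable_inf_exchangeGraph_omitted hG hp hpq i
  · obtain ⟨k, hk⟩ := hqr.2
    rw [hk, Function.update_of_ne hne] at h4
    refine Adj.reachable ⟨colorClass_adj.2 ⟨?_, h4⟩, h2⟩
    simpa [deleteEdges_adj, deleteEdges_le _ h3] using hne

lemma reachable_inf_exchangeGraph
    (hG : ¬ ∃ f : Sym2 V → β, ∀ i, (colorClass G f i).IsAcyclic)
    (hp : IsForestColoringOff G p) (i : β) (h : (exchangeGraph G p).Reachable x y) :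
    (colorClass (G.deleteEdges {p.2}) p.1 i ⊓ exchangeGraph G p).Reachable x y := by
  refine reachable_of_forall_adj (fun a b hab ↦ ?_) h
  obtain ⟨f, hf⟩ := ((fromEdgeSet_adj _).1 hab).1
  have key : ∀ q, Relation.ReflTransGen (IsExchange G) p q →
      (colorClass (G.deleteEdges {q.2}) q.1 i ⊓ exchangeGraph G p).Reachable a b →
      (colorClass (G.deleteEdges {p.2}) p.1 i ⊓ exchangeGraph G p).Reachable a b := by
    intro q hq
    induction hq with
    | refl => exact id
    | tail hpq hqr ih =>
      exact fun h ↦ ih (reachable_inf_exchangeGraph_of_isExchange hG hp hpq hqr h)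
  exact key _ hf (reachable_inf_exchangeGraph_omitted hG hp hf i)

/-- If a graph `G` with a forest coloring off one edge has no forest coloring, then some set of
vertices containing that edge is connected in each color class. -/
lemma exists_connected_induce_colorClass
    (hG : ¬ ∃ f : Sym2 V → β, ∀ i, (colorClass G f i).IsAcyclic)
    (hf : IsForestColoringOff G (f, s(x, y))) :
    ∃ s : Set V, x ∈ s ∧ y ∈ s ∧
      ∀ i, ((colorClass (G.deleteEdges {s(x, y)}) f i).induce s).Connected := by
  set H := exchangeGraph G (f, s(x, y))
  refine ⟨(H.connectedComponentMk x).supp, rfl, ?_, fun i ↦ ?_⟩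
  · refine ConnectedComponent.sound (Adj.reachable ?_)
    exact ((fromEdgeSet_adj _).2 ⟨⟨f, .refl⟩, G.ne_of_adj hf.1⟩ : H.Adj x y).symm
  · set K := colorClass (G.deleteEdges {s(x, y)}) f i ⊓ H
    have hsupp : (H.connectedComponentMk x).supp = (K.connectedComponentMk x).supp := by
      ext z
      simp only [ConnectedComponent.mem_supp_iff, ConnectedComponent.eq]
      exact ⟨reachable_inf_exchangeGraph hG hf i, fun h ↦ h.mono inf_le_right⟩
    rw [hsupp]
    exact (K.connectedComponentMk x).connected_toSimpleGraph.mono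
      (comap_monotone _ inf_le_left)

/-- The sufficiency direction of the **Nash-Williams arboricity theorem**. -/
theorem exists_forall_isAcyclic_colorClass [Finite V] [Fintype β] [Nonempty β]
    (G : SimpleGraph V)
    (h : ∀ s : Set V, s.Nonempty →
      (G.induce s).edgeSet.ncard ≤ Fintype.card β * (s.ncard - 1)) :
    ∃ f : Sym2 V → β, ∀ i, (colorClass G f i).IsAcyclic := by
  classical
  induction G using WellFoundedLT.induction with
  | ind G ih =>
  by_contra hG
  obtain rfl | hne := eq_or_ne G ⊥
  · exact hG ⟨fun _ ↦ Classical.arbitrary β, fun i ↦ isAcyclic_bot.anti colorClass_le⟩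
  obtain ⟨x, y, hxy⟩ := ne_bot_iff_exists_adj.1 hne
  have hlt : G.deleteEdges {s(x, y)} < G := by
    refine lt_of_le_of_ne (deleteEdges_le _) fun heq ↦ ?_
    rw [← heq] at hxy
    simp [deleteEdges_adj] at hxy
  obtain ⟨f, hf⟩ := ih _ hlt fun s hs ↦ (Set.ncard_le_ncard
    (edgeSet_mono (comap_monotone _ hlt.le)) (Set.toFinite _)).trans (h s hs)
  obtain ⟨s, hx, hy, hs⟩ := exists_connected_induce_colorClass hG (f := f) ⟨hxy, hf⟩
  set F := fun i ↦ ((colorClass (G.deleteEdges {s(x, y)}) f i).induce s) with hF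
  set e : Sym2 s := s(⟨x, hx⟩, ⟨y, hy⟩) with he
  have hcard (i : β) : s.ncard - 1 ≤ (F i).edgeSet.ncard := by
    have := (hs i).card_vert_le_card_edgeSet_add_one
    simp only [Nat.card_coe_set_eq] at this
    simp only [hF]
    omega
  have hdisj : Pairwise (Function.onFun Disjoint fun i ↦ (F i).edgeSet) := by
    intro i j hij
    refine disjoint_edgeSet.2 (disjoint_left.2 fun a b hi hj ↦ hij ?_)
    exact (colorClass_adj.1 hi).2.symm.trans (colorClass_adj.1 hj).2
  have hunion : (⋃ i, (F i).edgeSet).ncard = ∑ i, (F i).edgeSet.ncard := by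
    rw [Set.ncard_iUnion_of_finite (fun _ ↦ Set.toFinite _) hdisj, finsum_eq_sum_of_fintype]
  have hnot : e ∉ ⋃ i, (F i).edgeSet := by
    simp [hF, he, colorClass_adj]
  have hsub : insert e (⋃ i, (F i).edgeSet) ⊆ (G.induce s).edgeSet := by
    refine Set.insert_subset hxy (Set.iUnion_subset fun i ↦ ?_)
    exact edgeSet_mono (comap_monotone _ (colorClass_le.trans hlt.le))
  have hle := Set.ncard_le_ncard hsub (Set.toFinite _)
  rw [Set.ncard_insert_of_notMem hnot (Set.toFinite _), hunion] at hle
  have hsum := Finset.sum_le_sum fun i (_ : i ∈ Finset.univ) ↦ hcard i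
  simp only [Finset.sum_const, Finset.card_univ, smul_eq_mul] at hsum
  have := h s ⟨x, hx⟩
  omega

end SimpleGraph

/-- If every nonempty induced subgraph `G[V']` of a finite simple graph `G` has at most
`2|V'| - 2` edges, then the edge set of `G` can be partitioned into two forests. -/
theorem two_forest_partition_of_density {V : Type*} [Fintype V] (G : SimpleGraph V)
    (h : ∀ V' : Finset V, V'.Nonempty →
      (G.induce (V' : Set V)).edgeSet.ncard ≤ 2 * V'.card - 2) :
    ∃ f : Sym2 V → Bool, ∀ b : Bool, (colorClass G f b).IsAcyclic := by
  classical
  refine exists_forall_isAcyclic_colorClass G fun s hs ↦ ?_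
  have := h s.toFinset (Set.toFinset_nonempty.2 hs)
  rw [Set.coe_toFinset, ← Set.ncard_eq_toFinset_card'] at this
  rw [Fintype.card_bool]
  omega
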